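/- If h : ℝ → ℝ is differentiable with bounded derivative, then the solution y of the Stein equation is twice differentiable and satisfies ‖y''‖_∞ ≤ 2(1−ψ)^{−1/2}·‖h'‖_∞. -/

import Mathlib

open MeasureTheory ProbabilityTheory Real Set
open Filter Topology

noncomputable section

/-- `h̄_ψ = E h(N)` for `N ~ N(0, (1-ψ)⁻¹)`. -/
def gaussMean (ψ : ℝ) (h : ℝ → ℝ) : ℝ :=
  ∫ x, h x ∂(gaussianReal 0 (Real.toNNReal (1 - ψ)⁻¹))

/-- The bounded solution `y` of the Stein equation
`y'(x) - (1-ψ) x y(x) = h(x) - h̄_ψ`, given explicitly by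
`y(x) = -e^{(1-ψ)x²/2} ∫_x^∞ e^{-(1-ψ)t²/2} (h(t) - h̄_ψ) dt`. -/
def steinSol (ψ : ℝ) (h : ℝ → ℝ) (x : ℝ) : ℝ :=
  - Real.exp ((1 - ψ) * x ^ 2 / 2) *
      ∫ t in Set.Ioi x, Real.exp (-((1 - ψ) * t ^ 2 / 2)) * (h t - gaussMean ψ h)

section GaussianWeight

variable {a : ℝ}

lemma hasDerivAt_exp_neg_mul_sq_div_two (a x : ℝ) :
    HasDerivAt (fun t => exp (-(a * t ^ 2 / 2))) (-(a * x) * exp (-(a * x ^ 2 / 2))) x := by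
  have hq : HasDerivAt (fun t : ℝ => -(a * t ^ 2 / 2)) (-(a * x)) x := by
    refine ((((hasDerivAt_id' x).pow 2).const_mul a).div_const 2).neg.congr_deriv ?_
    norm_num
    ring
  exact hq.exp.congr_deriv (mul_comm _ _)

lemma integrable_exp_neg_mul_sq_div_two (ha : 0 < a) :
    Integrable fun t : ℝ => exp (-(a * t ^ 2 / 2)) := by
  refine (integrable_exp_neg_mul_sq (half_pos ha)).congr (ae_of_all _ fun t => ?_)
  ring_nf

lemma integrable_exp_neg_mul_sq_div_two_mul_id (ha : 0 < a) :
    Integrable fun t : ℝ => exp (-(a * t ^ 2 / 2)) * t := by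
  refine (integrable_mul_exp_neg_mul_sq (half_pos ha)).congr (ae_of_all _ fun t => ?_)
  ring_nf

lemma tendsto_exp_neg_mul_sq_div_two_atTop (ha : 0 < a) :
    Tendsto (fun t : ℝ => exp (-(a * t ^ 2 / 2))) atTop (𝓝 0) := by
  refine tendsto_exp_neg_atTop_nhds_zero.comp ?_
  exact ((tendsto_pow_atTop two_ne_zero).const_mul_atTop ha).atTop_div_const two_pos

lemma integral_Ioi_exp_neg_mul_sq_div_two_mul_id (ha : 0 < a) (x : ℝ) :
    ∫ t in Ioi x, exp (-(a * t ^ 2 / 2)) * t = exp (-(a * x ^ 2 / 2)) / a := by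
  have hd : ∀ t ∈ Ici x, HasDerivAt (fun t => -(exp (-(a * t ^ 2 / 2)) / a))
      (exp (-(a * t ^ 2 / 2)) * t) t := fun t _ => by
    refine ((hasDerivAt_exp_neg_mul_sq_div_two a t).div_const a).neg.congr_deriv ?_
    field_simp
  have hlim : Tendsto (fun t : ℝ => -(exp (-(a * t ^ 2 / 2)) / a)) atTop (𝓝 0) := by
    simpa using ((tendsto_exp_neg_mul_sq_div_two_atTop ha).div_const a).neg
  rw [integral_Ioi_of_hasDerivAt_of_tendsto' hd
    (integrable_exp_neg_mul_sq_div_two_mul_id ha).integrableOn hlim]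
  ring

lemma integral_exp_neg_mul_sq_div_two_mul_id (a : ℝ) :
    ∫ t : ℝ, exp (-(a * t ^ 2 / 2)) * t = 0 := by
  have h := integral_neg_eq_self (fun t : ℝ => exp (-(a * t ^ 2 / 2)) * t) volume
  simp only [neg_sq, mul_neg, integral_neg] at h
  linarith

/-- The lower Mills ratio bound for the Gaussian tail. -/
lemma mul_exp_le_integral_Ioi_exp_neg_mul_sq_div_two (ha : 0 < a) (x : ℝ) :
    x * exp (-(a * x ^ 2 / 2)) ≤ (1 + a * x ^ 2) * ∫ t in Ioi x, exp (-(a * t ^ 2 / 2)) := by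
  have hpos : ∀ t : ℝ, 0 < 1 + a * t ^ 2 := fun t => by positivity
  have hd : ∀ t ∈ Ici x, HasDerivAt
      (fun t => -(t / (1 + a * t ^ 2) * exp (-(a * t ^ 2 / 2))))
      ((1 - 2 / (1 + a * t ^ 2) ^ 2) * exp (-(a * t ^ 2 / 2))) t := fun t _ => by
    have hden : HasDerivAt (fun t : ℝ => 1 + a * t ^ 2) (2 * a * t) t := by
      refine ((((hasDerivAt_id' t).pow 2).const_mul a).const_add 1).congr_deriv ?_
      norm_num
      ring
    refine (((hasDerivAt_id' t).fun_div hden (hpos t).ne').fun_mul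
      (hasDerivAt_exp_neg_mul_sq_div_two a t)).neg.congr_deriv ?_
    have := (hpos t).ne'
    field_simp
    ring
  have hle : ∀ t : ℝ, 2 / (1 + a * t ^ 2) ^ 2 ≤ 2 := fun t =>
    div_le_self two_pos.le (one_le_pow₀ (by nlinarith [sq_nonneg t]))
  have hint : Integrable fun t : ℝ =>
      (1 - 2 / (1 + a * t ^ 2) ^ 2) * exp (-(a * t ^ 2 / 2)) := by
    refine (integrable_exp_neg_mul_sq_div_two ha).mono' ?_ (ae_of_all _ fun t => ?_)
    · refine Continuous.aestronglyMeasurable ?_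
      have : ∀ t : ℝ, (1 + a * t ^ 2) ^ 2 ≠ 0 := fun t => (pow_pos (hpos t) 2).ne'
      fun_prop (disch := assumption)
    · rw [norm_mul, norm_of_nonneg (exp_pos _).le]
      refine mul_le_of_le_one_left (exp_pos _).le ?_
      rw [Real.norm_eq_abs, abs_le]
      have h0 : 0 ≤ 2 / (1 + a * t ^ 2) ^ 2 := by positivity
      constructor <;> linarith [hle t]
  have hlim : Tendsto (fun t : ℝ => -(t / (1 + a * t ^ 2) * exp (-(a * t ^ 2 / 2))))
      atTop (𝓝 0) := by
    rw [← neg_zero]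
    refine Tendsto.neg (squeeze_zero' ?_ ?_ (tendsto_exp_neg_mul_sq_div_two_atTop ha))
    · filter_upwards [eventually_ge_atTop 0] with t ht
      positivity
    · filter_upwards [eventually_ge_atTop a⁻¹] with t ht
      refine mul_le_of_le_one_left (exp_pos _).le ?_
      rw [div_le_one (hpos t)]
      have h1 : 1 ≤ a * t := by
        simpa [ha.ne'] using mul_le_mul_of_nonneg_left ht ha.le
      nlinarith [(inv_pos.2 ha).trans_le ht]
  have hFTC := integral_Ioi_of_hasDerivAt_of_tendsto' hd hint.integrableOn hlim
  have hmono : ∫ t in Ioi x, (1 - 2 / (1 + a * t ^ 2) ^ 2) * exp (-(a * t ^ 2 / 2)) ≤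
      ∫ t in Ioi x, exp (-(a * t ^ 2 / 2)) := by
    refine integral_mono hint.integrableOn
      (integrable_exp_neg_mul_sq_div_two ha).integrableOn fun t => ?_
    refine mul_le_of_le_one_left (exp_pos _).le ?_
    have h0 : 0 ≤ 2 / (1 + a * t ^ 2) ^ 2 := by positivity
    linarith
  rw [hFTC, zero_sub, neg_neg, div_mul_eq_mul_div, div_le_iff₀' (hpos x)] at hmono
  exact hmono

lemma neg_mul_exp_le_integral_Iic_exp_neg_mul_sq_div_two (ha : 0 < a) (x : ℝ) :
    -(x * exp (-(a * x ^ 2 / 2))) ≤ (1 + a * x ^ 2) * ∫ t in Iic x, exp (-(a * t ^ 2 / 2)) := by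
  have h := mul_exp_le_integral_Ioi_exp_neg_mul_sq_div_two ha (-x)
  rw [← integral_comp_neg_Iic x] at h
  simpa only [neg_sq, neg_mul] using h

/-- A monotone function which is centred for the Gaussian weight satisfies a tail bound of Mills
ratio type. -/
lemma Monotone.mul_exp_le_integral_Ioi {g : ℝ → ℝ} (hg : Monotone g) (ha : 0 < a)
    (hint : Integrable fun t => exp (-(a * t ^ 2 / 2)) * g t)
    (hzero : ∫ t, exp (-(a * t ^ 2 / 2)) * g t = 0) (x : ℝ) :
    x * exp (-(a * x ^ 2 / 2)) * g x ≤
      (1 + a * x ^ 2) * ∫ t in Ioi x, exp (-(a * t ^ 2 / 2)) * g t := by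
  have hpos : 0 ≤ 1 + a * x ^ 2 := by positivity
  have hφ := integrable_exp_neg_mul_sq_div_two ha
  rcases le_total 0 (g x) with hx | hx
  · have hle : (∫ t in Ioi x, exp (-(a * t ^ 2 / 2))) * g x ≤
        ∫ t in Ioi x, exp (-(a * t ^ 2 / 2)) * g t := by
      rw [← integral_mul_const]
      exact setIntegral_mono_on (hφ.mul_const _).integrableOn hint.integrableOn measurableSet_Ioi
        fun t ht => mul_le_mul_of_nonneg_left (hg (le_of_lt ht)) (exp_pos _).le
    have hM := mul_le_mul_of_nonneg_right
      (mul_exp_le_integral_Ioi_exp_neg_mul_sq_div_two ha x) hx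
    linarith [mul_le_mul_of_nonneg_left hle hpos]
  · have hle : ∫ t in Iic x, exp (-(a * t ^ 2 / 2)) * g t ≤
        (∫ t in Iic x, exp (-(a * t ^ 2 / 2))) * g x := by
      rw [← integral_mul_const]
      exact setIntegral_mono_on hint.integrableOn (hφ.mul_const _).integrableOn measurableSet_Iic
        fun t ht => mul_le_mul_of_nonneg_left (hg ht) (exp_pos _).le
    have hsum := intervalIntegral.integral_Iic_add_Ioi (b := x) hint.integrableOn hint.integrableOn
    rw [hzero, ← eq_neg_iff_add_eq_zero] at hsum
    rw [hsum] at hle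
    have hM := mul_le_mul_of_nonpos_right
      (neg_mul_exp_le_integral_Iic_exp_neg_mul_sq_div_two ha x) hx
    linarith [mul_le_mul_of_nonneg_left hle hpos]

lemma integrable_exp_neg_mul_sq_div_two_mul_of_abs_deriv_le (ha : 0 < a) {g : ℝ → ℝ}
    (hg : Differentiable ℝ g) {C : ℝ} (hC : ∀ x, |deriv g x| ≤ C) :
    Integrable fun t => exp (-(a * t ^ 2 / 2)) * g t := by
  have hbound : ∀ t, |g t| ≤ |g 0| + C * |t| := fun t => by
    have h := Convex.norm_image_sub_le_of_norm_deriv_le (f := g) (C := C)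
      (fun y _ => hg y) (fun y _ => hC y) convex_univ (mem_univ 0) (mem_univ t)
    rw [sub_zero, Real.norm_eq_abs, Real.norm_eq_abs] at h
    linarith [abs_sub_abs_le_abs_sub (g t) (g 0)]
  refine (((integrable_exp_neg_mul_sq_div_two ha).mul_const |g 0|).add
    ((integrable_exp_neg_mul_sq_div_two_mul_id ha).norm.const_mul C)).mono' ?_
    (ae_of_all _ fun t => ?_)
  · have := hg.continuous
    exact Continuous.aestronglyMeasurable (by fun_prop)
  · simp only [Pi.add_apply, norm_mul, Real.norm_eq_abs, abs_exp]
    linarith [mul_le_mul_of_nonneg_left (hbound t) (exp_pos (-(a * t ^ 2 / 2))).le]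

lemma mul_exp_sub_le_integral_Ioi_of_abs_deriv_le (ha : 0 < a) {g : ℝ → ℝ}
    (hg : Differentiable ℝ g) {C : ℝ} (hC : ∀ x, |deriv g x| ≤ C)
    (hzero : ∫ t, exp (-(a * t ^ 2 / 2)) * g t = 0) (x : ℝ) :
    a * x * exp (-(a * x ^ 2 / 2)) * g x - C * exp (-(a * x ^ 2 / 2)) ≤
      a * (1 + a * x ^ 2) * ∫ t in Ioi x, exp (-(a * t ^ 2 / 2)) * g t := by
  have hmono : Monotone fun t => g t + t * C := by
    refine monotone_of_deriv_nonneg (by fun_prop) fun t => ?_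
    rw [((hg t).hasDerivAt.fun_add ((hasDerivAt_id' t).mul_const C)).deriv]
    linarith [(abs_le.1 (hC t)).1]
  have hgi := integrable_exp_neg_mul_sq_div_two_mul_of_abs_deriv_le ha hg hC
  have hid := (integrable_exp_neg_mul_sq_div_two_mul_id ha).mul_const C
  have h := hmono.mul_exp_le_integral_Ioi ha (by simpa only [mul_add, ← mul_assoc] using hgi.fun_add hid)
    (by
      simp only [mul_add, ← mul_assoc]
      rw [integral_add hgi hid, integral_mul_const, integral_exp_neg_mul_sq_div_two_mul_id, hzero]
      ring) x
  simp only [mul_add (exp _), ← mul_assoc (exp _)] at h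
  rw [integral_add hgi.integrableOn hid.integrableOn, integral_mul_const,
    integral_Ioi_exp_neg_mul_sq_div_two_mul_id ha] at h
  have h' := mul_le_mul_of_nonneg_left h ha.le
  have hcancel : a * (exp (-(a * x ^ 2 / 2)) / a) = exp (-(a * x ^ 2 / 2)) := by field_simp
  linear_combination h' + (1 + a * x ^ 2) * C * hcancel

/-- The two-sided tail estimate behind the bound on the second derivative of the solution of the
Stein equation. -/
lemma abs_integral_Ioi_sub_le_of_abs_deriv_le (ha : 0 < a) {g : ℝ → ℝ}
    (hg : Differentiable ℝ g) {C : ℝ} (hC : ∀ x, |deriv g x| ≤ C)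
    (hzero : ∫ t, exp (-(a * t ^ 2 / 2)) * g t = 0) (x : ℝ) :
    |a * (1 + a * x ^ 2) * (∫ t in Ioi x, exp (-(a * t ^ 2 / 2)) * g t) -
      a * x * exp (-(a * x ^ 2 / 2)) * g x| ≤ C * exp (-(a * x ^ 2 / 2)) := by
  have h₁ := mul_exp_sub_le_integral_Ioi_of_abs_deriv_le ha hg hC hzero x
  have h₂ := mul_exp_sub_le_integral_Ioi_of_abs_deriv_le ha hg.fun_neg (C := C)
    (fun t => by rw [deriv.fun_neg, abs_neg]; exact hC t)
    (by simp only [mul_neg, integral_neg, hzero, neg_zero]) x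
  simp only [mul_neg, integral_neg] at h₂
  rw [abs_le]
  constructor <;> linarith

end GaussianWeight

lemma integral_exp_mul_eq_gaussMean {ψ : ℝ} (hψ : ψ < 1) (f : ℝ → ℝ) :
    ∫ t, exp (-((1 - ψ) * t ^ 2 / 2)) * f t = √(2 * π * (1 - ψ)⁻¹) * gaussMean ψ f := by
  have ha : 0 < 1 - ψ := sub_pos.2 hψ
  have hv : (1 - ψ)⁻¹.toNNReal ≠ 0 := (Real.toNNReal_pos.2 (inv_pos.2 ha)).ne'
  have hZ : √(2 * π * (1 - ψ)⁻¹) ≠ 0 := by positivity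
  rw [gaussMean, integral_gaussianReal_eq_integral_smul hv, ← integral_const_mul]
  refine integral_congr_ae (ae_of_all _ fun t => ?_)
  simp only [gaussianPDFReal, Real.coe_toNNReal _ (inv_pos.2 ha).le, smul_eq_mul, sub_zero]
  rw [← mul_assoc, mul_inv_cancel_left₀ hZ]
  congr 2
  field_simp

lemma integral_exp_mul_sub_gaussMean {ψ : ℝ} (hψ : ψ < 1) {h : ℝ → ℝ}
    (hint : Integrable fun t => exp (-((1 - ψ) * t ^ 2 / 2)) * h t) :
    ∫ t, exp (-((1 - ψ) * t ^ 2 / 2)) * (h t - gaussMean ψ h) = 0 := by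
  have hφ := (integrable_exp_neg_mul_sq_div_two (sub_pos.2 hψ)).mul_const (gaussMean ψ h)
  have hone := integral_exp_mul_eq_gaussMean hψ fun _ => 1
  simp only [gaussMean, integral_const, probReal_univ, smul_eq_mul, mul_one] at hone
  simp only [mul_sub]
  rw [integral_sub hint hφ, integral_mul_const, hone, integral_exp_mul_eq_gaussMean hψ, sub_self]

lemma hasDerivAt_integral_Ioi {f : ℝ → ℝ} (hf : Continuous f) (hint : Integrable f) (x : ℝ) :
    HasDerivAt (fun u => ∫ t in Ioi u, f t) (-f x) x := by
  have heq : (fun u => ∫ t in Ioi u, f t) = fun u => (∫ t in Ioi x, f t) - ∫ t in x..u, f t := by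
    ext u
    rw [← intervalIntegral.integral_Ioi_sub_Ioi' hint.integrableOn hint.integrableOn, sub_sub_cancel]
  rw [heq]
  exact (hf.integral_hasStrictDerivAt x x).hasDerivAt.const_sub _

/-- `steinSol` solves the Stein equation. -/
lemma hasDerivAt_steinSol {ψ : ℝ} {h : ℝ → ℝ} (hh : Continuous h)
    (hint : Integrable fun t => exp (-((1 - ψ) * t ^ 2 / 2)) * (h t - gaussMean ψ h)) (x : ℝ) :
    HasDerivAt (steinSol ψ h) ((1 - ψ) * x * steinSol ψ h x + (h x - gaussMean ψ h)) x := by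
  have hexp : HasDerivAt (fun t => -exp ((1 - ψ) * t ^ 2 / 2))
      (-((1 - ψ) * x * exp ((1 - ψ) * x ^ 2 / 2))) x := by
    simpa only [neg_mul, neg_div, neg_neg] using (hasDerivAt_exp_neg_mul_sq_div_two (-(1 - ψ)) x).fun_neg
  refine (hexp.mul (hasDerivAt_integral_Ioi (by fun_prop) hint x)).congr_deriv ?_
  have hcancel : exp ((1 - ψ) * x ^ 2 / 2) * exp (-((1 - ψ) * x ^ 2 / 2)) = 1 := by
    rw [← exp_add, add_neg_cancel, exp_zero]
  rw [steinSol]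
  linear_combination (h x - gaussMean ψ h) * hcancel

theorem stmt14 (ψ : ℝ) (hψ0 : 0 ≤ ψ) (hψ1 : ψ < 1) (h : ℝ → ℝ) (hdiff : Differentiable ℝ h) (C : ℝ) (hC : ∀ x, |deriv h x| ≤ C) :
    Differentiable ℝ (steinSol ψ h) ∧
    Differentiable ℝ (deriv (steinSol ψ h)) ∧
    ∀ x : ℝ, |deriv (deriv (steinSol ψ h)) x| ≤ 2 / Real.sqrt (1 - ψ) * C := by
  have ha : 0 < 1 - ψ := sub_pos.2 hψ1
  have hg : Differentiable ℝ fun t => h t - gaussMean ψ h := hdiff.sub_const _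
  have hgC : ∀ x, |deriv (fun t => h t - gaussMean ψ h) x| ≤ C := fun x => by
    rw [deriv_sub_const]
    exact hC x
  have hzero := integral_exp_mul_sub_gaussMean hψ1
    (integrable_exp_neg_mul_sq_div_two_mul_of_abs_deriv_le ha hdiff hC)
  have hy := hasDerivAt_steinSol hdiff.continuous
    (integrable_exp_neg_mul_sq_div_two_mul_of_abs_deriv_le ha hg hgC)
  have hy' : deriv (steinSol ψ h) =
      fun x => (1 - ψ) * x * steinSol ψ h x + (h x - gaussMean ψ h) :=
    funext fun x => (hy x).deriv
  have hy'' : ∀ x, HasDerivAt (deriv (steinSol ψ h))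
      (deriv h x - exp ((1 - ψ) * x ^ 2 / 2) *
        ((1 - ψ) * (1 + (1 - ψ) * x ^ 2) *
          (∫ t in Ioi x, exp (-((1 - ψ) * t ^ 2 / 2)) * (h t - gaussMean ψ h)) -
        (1 - ψ) * x * exp (-((1 - ψ) * x ^ 2 / 2)) * (h x - gaussMean ψ h))) x := fun x => by
    rw [hy']
    refine ((((hasDerivAt_id' x).const_mul (1 - ψ)).mul (hy x)).add
      ((hdiff x).hasDerivAt.sub_const _)).congr_deriv ?_
    have hcancel : exp ((1 - ψ) * x ^ 2 / 2) * exp (-((1 - ψ) * x ^ 2 / 2)) = 1 := by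
      rw [← exp_add, add_neg_cancel, exp_zero]
    rw [steinSol]
    linear_combination -(1 - ψ) * x * (h x - gaussMean ψ h) * hcancel
  refine ⟨fun x => (hy x).differentiableAt, fun x => (hy'' x).differentiableAt, fun x => ?_⟩
  have hC0 : 0 ≤ C := (abs_nonneg _).trans (hC 0)
  have hmain : |deriv (deriv (steinSol ψ h)) x| ≤ 2 * C := by
    rw [(hy'' x).deriv]
    have hw := mul_le_mul_of_nonneg_left
      (abs_integral_Ioi_sub_le_of_abs_deriv_le ha hg hgC hzero x)
      (exp_pos ((1 - ψ) * x ^ 2 / 2)).le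
    rw [mul_left_comm, ← exp_add, add_neg_cancel, exp_zero, mul_one] at hw
    refine (abs_sub _ _).trans ?_
    rw [abs_mul, abs_exp]
    linarith [hC x]
  refine hmain.trans (mul_le_mul_of_nonneg_right ?_ hC0)
  rw [le_div_iff₀ (sqrt_pos.2 ha)]
  linarith [sqrt_le_one.2 (show 1 - ψ ≤ 1 by linarith)]

end
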